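/- Let k ∈ ℕ and let f ∈ L_1(𝕋) have Fourier series f(x) ~ ∑_{n=1}^∞ a_n cos nx, where {a_n} is a decreasing convex sequence such that for some ε > 0, a_n n^{k−ε} ≤ C a_m m^{k−ε} whenever n ≤ m. Then there is C' > 0 such that ω_k(f,t)_1 ≤ C' t f^{**}(t) for all t ∈ (0,1). -/

import Mathlib

open MeasureTheory ENNReal Set Filter Real

noncomputable section

/-- Non-increasing rearrangement of an `ℝ≥0∞`-valued function w.r.t. a measure. -/
def rearr {α : Type*} [MeasurableSpace α] (μ : Measure α) (g : α → ℝ≥0∞) (t : ℝ) : ℝ≥0∞ :=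
  sInf {l : ℝ≥0∞ | μ {x | l < g x} ≤ ENNReal.ofReal t}

/-- Non-increasing rearrangement of a real-valued function. -/
def rearrR {α : Type*} [MeasurableSpace α] (μ : Measure α) (f : α → ℝ) (t : ℝ) : ℝ≥0∞ :=
  rearr μ (fun x => ENNReal.ofReal |f x|) t

/-- The maximal function `f^{**}(t) = t⁻¹ ∫_0^t f^*`. -/
def rearrStar {α : Type*} [MeasurableSpace α] (μ : Measure α) (f : α → ℝ) (t : ℝ) : ℝ≥0∞ :=
  (ENNReal.ofReal t)⁻¹ * ∫⁻ s in Set.Ioo (0:ℝ) t, rearrR μ f s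

/-- `(∫_I g(t)^q dt/t)^{1/q}`, with the usual sup modification when `q = ∞`. -/
def qnorm (q : ℝ≥0∞) (I : Set ℝ) (g : ℝ → ℝ≥0∞) : ℝ≥0∞ :=
  if q = ∞ then ⨆ t ∈ I, g t
  else (∫⁻ t in I, g t ^ q.toReal / ENNReal.ofReal t) ^ (1 / q.toReal)

/-- the measure of the torus `(0, 2π)` -/
def torusMeasure : Measure ℝ := volume.restrict (Set.Ioo 0 (2 * π))

/-- intervals -/
def IsInterval (Q : Set ℝ) : Prop := ∃ a l : ℝ, 0 < l ∧ Q = Set.Icc a (a + l)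

/-- the sharp maximal function on the line -/
def sharpT (f : ℝ → ℝ) (x : ℝ) : ℝ≥0∞ :=
  ⨆ Q ∈ {Q : Set ℝ | IsInterval Q ∧ x ∈ Q},
    ENNReal.ofReal (⨍ y in Q, |f y - ⨍ z in Q, f z|)

def diffOpT (h : ℝ) (f : ℝ → ℝ) : ℝ → ℝ := fun x => f (x + h) - f x

def iterDiffT (k : ℕ) (h : ℝ) (f : ℝ → ℝ) : ℝ → ℝ := (diffOpT h)^[k] f

def lorentzT (f : ℝ → ℝ) (p : ℝ) (q : ℝ≥0∞) : ℝ≥0∞ :=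
  qnorm q (Set.Ioo 0 1) (fun t => ENNReal.ofReal (t ^ (1 / p)) * rearrR torusMeasure f t)

/-- modulus of smoothness on the torus -/
def modulusT (k : ℕ) (f : ℝ → ℝ) (p : ℝ) (q : ℝ≥0∞) (t : ℝ) : ℝ≥0∞ :=
  ⨆ h ∈ {h : ℝ | |h| ≤ t}, lorentzT (iterDiffT k h f) p q

/-- first-order modulus in `L_1(𝕋)` -/
def modulusL1T (k : ℕ) (f : ℝ → ℝ) (t : ℝ) : ℝ≥0∞ :=
  ⨆ h ∈ {h : ℝ | |h| ≤ t}, ∫⁻ x in Set.Ioo 0 (2 * π), ENNReal.ofReal |iterDiffT k h f x|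

/-- a slowly varying function -/
def SlowlyVarying (b : ℝ → ℝ) : Prop :=
  ∀ lam : ℝ, 0 < lam → Tendsto (fun t => b (lam * t) / b t) atTop (nhds 1)



namespace S19

/-- trigonometric polynomial with coefficients `c j`, `j < N` -/
def P (N : ℕ) (c : ℕ → ℂ) (x : ℝ) : ℂ :=
  ∑ j ∈ Finset.range N, c j * Complex.exp (Complex.I * ((j * x : ℝ) : ℂ))

lemma P_cont (N : ℕ) (c : ℕ → ℂ) : Continuous (P N c) := by
  unfold P; fun_prop

lemma int_exp (m : ℤ) : (∫ x in Set.Ioo (0:ℝ) (2 * π), Complex.exp (Complex.I * ((m * x : ℝ) : ℂ)))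
    = if m = 0 then ((2 * π : ℝ) : ℂ) else 0 := by
  rw [← integral_Ioc_eq_integral_Ioo, ← intervalIntegral.integral_of_le (by positivity)]
  split_ifs with h
  · subst h; simp
  · have hc : Complex.I * (m : ℂ) ≠ 0 := by simp [h]
    have := integral_exp_mul_complex (a := 0) (b := 2 * π) hc
    have e : ∀ x : ℝ, Complex.exp (Complex.I * ((m * x : ℝ) : ℂ)) = Complex.exp (Complex.I * (m:ℂ) * x) := by
      intro x; congr 1; push_cast; ring
    simp_rw [e]
    rw [this]
    have : Complex.exp (Complex.I * (m : ℂ) * ((2 * π : ℝ) : ℂ)) = 1 := by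
      rw [Complex.exp_eq_one_iff]; exact ⟨m, by push_cast; ring⟩
    rw [this]; simp

lemma P_mul_conj (N : ℕ) (c d : ℕ → ℂ) (x : ℝ) :
    P N c x * (starRingEnd ℂ) (P N d x) = ∑ p ∈ Finset.range N, ∑ q ∈ Finset.range N,
      c p * (starRingEnd ℂ) (d q) * Complex.exp (Complex.I * ((((p:ℤ) - (q:ℤ) : ℤ) * x : ℝ) : ℂ)) := by
  unfold P
  rw [map_sum, Finset.sum_mul_sum]
  refine Finset.sum_congr rfl fun p _ => Finset.sum_congr rfl fun q _ => ?_
  rw [map_mul, ← Complex.exp_conj]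
  have : Complex.exp (Complex.I * ((((p:ℤ) - (q:ℤ) : ℤ) * x : ℝ) : ℂ))
    = Complex.exp (Complex.I * ((p * x : ℝ) : ℂ)) * Complex.exp ((starRingEnd ℂ) (Complex.I * ((q * x : ℝ) : ℂ))) := by
    rw [← Complex.exp_add]; congr 1
    rw [map_mul, Complex.conj_I, Complex.conj_ofReal]
    push_cast; ring
  rw [this]; ring

lemma contInt {f : ℝ → ℂ} (hf : Continuous f) : IntegrableOn f (Set.Ioo (0:ℝ) (2 * π)) volume :=
  (hf.integrableOn_Icc (a := 0) (b := 2 * π)).mono_set Ioo_subset_Icc_self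

lemma contIntR {f : ℝ → ℝ} (hf : Continuous f) : IntegrableOn f (Set.Ioo (0:ℝ) (2 * π)) volume :=
  (hf.integrableOn_Icc (a := 0) (b := 2 * π)).mono_set Ioo_subset_Icc_self

lemma int_P (N : ℕ) (c d : ℕ → ℂ) (m : ℕ) :
    (∫ x in Set.Ioo (0:ℝ) (2 * π), P N c x * (starRingEnd ℂ) (P N d x) *
      Complex.exp (Complex.I * ((m * x : ℝ) : ℂ)))
    = ∑ p ∈ Finset.range (N - m), c p * (starRingEnd ℂ) (d (p + m)) * ((2 * π : ℝ) : ℂ) := by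
  have e : ∀ x : ℝ, P N c x * (starRingEnd ℂ) (P N d x) *
      Complex.exp (Complex.I * ((m * x : ℝ) : ℂ)) = ∑ p ∈ Finset.range N, ∑ q ∈ Finset.range N,
      c p * (starRingEnd ℂ) (d q) * Complex.exp (Complex.I * ((((p:ℤ) - (q:ℤ) + m : ℤ) * x : ℝ) : ℂ)) := by
    intro x
    rw [P_mul_conj, Finset.sum_mul]
    refine Finset.sum_congr rfl fun p _ => ?_
    rw [Finset.sum_mul]
    refine Finset.sum_congr rfl fun q _ => ?_
    rw [mul_assoc, ← Complex.exp_add]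
    congr 2
    push_cast; ring
  simp_rw [e]
  rw [integral_finsetSum _ (fun p _ => contInt (by fun_prop))]
  have e2 : ∀ p ∈ Finset.range N, (∫ x in Set.Ioo (0:ℝ) (2 * π), ∑ q ∈ Finset.range N,
      c p * (starRingEnd ℂ) (d q) * Complex.exp (Complex.I * ((((p:ℤ) - (q:ℤ) + m : ℤ) * x : ℝ) : ℂ)))
      = if p ∈ Finset.range (N - m) then c p * (starRingEnd ℂ) (d (p + m)) * ((2 * π : ℝ) : ℂ) else 0 := by
    intro p _
    rw [integral_finsetSum _ (fun p _ => contInt (by fun_prop))]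
    simp_rw [integral_const_mul, int_exp]
    have e3 : ∀ q ∈ Finset.range N, c p * (starRingEnd ℂ) (d q) *
        (if ((p:ℤ) - (q:ℤ) + m : ℤ) = 0 then ((2 * π : ℝ) : ℂ) else 0) =
        if p + m = q then c p * (starRingEnd ℂ) (d (p + m)) * ((2 * π : ℝ) : ℂ) else 0 := by
      intro q _
      by_cases h : p + m = q
      · rw [if_pos (by omega), if_pos h, h]
      · rw [if_neg (by omega), if_neg h, mul_zero]
    rw [Finset.sum_congr rfl e3, Finset.sum_ite_eq]
    by_cases h : p < N - m
    · rw [if_pos (by simp; omega), if_pos (by simpa using h)]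
    · rw [if_neg (by simp; omega), if_neg (by simpa using h)]
  rw [Finset.sum_congr rfl e2, ← Finset.sum_filter]
  refine Finset.sum_congr ?_ fun _ _ => rfl
  ext p; simp; omega

/-- the (unnormalised) Fejer kernel -/
def K (N : ℕ) (x : ℝ) : ℝ := ‖P N (fun _ => 1) x‖ ^ 2

lemma K_cont (N : ℕ) : Continuous (K N) := by
  unfold K; have := P_cont N (fun _ => 1); fun_prop

lemma K_nonneg (N : ℕ) (x : ℝ) : 0 ≤ K N x := by unfold K; positivity

lemma K_coe (N : ℕ) (x : ℝ) : (K N x : ℂ) = P N (fun _ => 1) x * (starRingEnd ℂ) (P N (fun _ => 1) x) := by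
  rw [Complex.mul_conj, K, Complex.normSq_eq_norm_sq]

lemma int_K_exp (N m : ℕ) : (∫ x in Set.Ioo (0:ℝ) (2 * π), (K N x : ℂ) *
    Complex.exp (Complex.I * ((m * x : ℝ) : ℂ))) = ((2 * π * (N - m : ℕ) : ℝ) : ℂ) := by
  simp_rw [K_coe]
  rw [int_P]
  simp; ring

lemma int_K_cos (N m : ℕ) : (∫ x in Set.Ioo (0:ℝ) (2 * π), K N x * Real.cos (m * x))
    = 2 * π * (N - m : ℕ) := by
  have h := congrArg Complex.re (int_K_exp N m)
  rw [Complex.ofReal_re] at h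
  rw [← h]
  have hi : IntegrableOn (fun x : ℝ => (K N x : ℂ) *
    Complex.exp (Complex.I * ((m * x : ℝ) : ℂ))) (Set.Ioo (0:ℝ) (2 * π)) volume :=
    contInt (by have := K_cont N; fun_prop)
  have := integral_re (𝕜 := ℂ) hi
  simp only [RCLike.re_eq_complex_re] at this
  rw [← this]
  congr 1; ext x
  rw [Complex.re_ofReal_mul, mul_comm Complex.I, Complex.exp_ofReal_mul_I_re]

lemma int_K_sin (N m : ℕ) : (∫ x in Set.Ioo (0:ℝ) (2 * π), K N x * Real.sin (m * x))
    = 0 := by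
  have h := congrArg Complex.im (int_K_exp N m)
  rw [Complex.ofReal_im] at h
  have hi : IntegrableOn (fun x : ℝ => (K N x : ℂ) *
    Complex.exp (Complex.I * ((m * x : ℝ) : ℂ))) (Set.Ioo (0:ℝ) (2 * π)) volume :=
    contInt (by have := K_cont N; fun_prop)
  have := integral_im (𝕜 := ℂ) hi
  simp only [RCLike.im_eq_complex_im] at this
  rw [← this] at h
  refine Eq.trans ?_ h
  congr 1; ext x
  rw [Complex.im_ofReal_mul, mul_comm Complex.I, Complex.exp_ofReal_mul_I_im]

lemma int_K (N : ℕ) : (∫ x in Set.Ioo (0:ℝ) (2 * π), K N x) = 2 * π * N := by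
  simpa using int_K_cos N 0

lemma lint_P_sq (N : ℕ) (c : ℕ → ℂ) (hc : ∀ j < N, ‖c j‖ ≤ 1) :
    (∫⁻ x in Set.Ioo (0:ℝ) (2 * π), ENNReal.ofReal (‖P N c x‖ ^ 2)) ≤ ENNReal.ofReal (2 * π * N) := by
  have hcont := P_cont N c
  rw [← ofReal_integral_eq_lintegral_ofReal (contIntR (by fun_prop)) (ae_of_all _ fun x => by positivity)]
  apply ENNReal.ofReal_le_ofReal
  have h := int_P N c c 0
  have h2 : ((∫ x in Set.Ioo (0:ℝ) (2 * π), ‖P N c x‖ ^ 2 : ℝ) : ℂ) =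
     ((∑ p ∈ Finset.range N, ‖c p‖ ^ 2 * (2 * π) : ℝ) : ℂ) := by
    rw [← integral_complex_ofReal]
    rw [Complex.ofReal_sum]
    refine Eq.trans ?_ (h.trans ?_)
    · congr 1; ext x; simp [Complex.mul_conj, Complex.normSq_eq_norm_sq]
    · refine Finset.sum_congr (by simp) fun p _ => ?_
      simp [Complex.mul_conj, Complex.normSq_eq_norm_sq]
  rw [Complex.ofReal_inj.1 h2]
  calc ∑ p ∈ Finset.range N, ‖c p‖ ^ 2 * (2 * π) ≤ ∑ p ∈ Finset.range N, 1 * (2 * π) := by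
        refine Finset.sum_le_sum fun p hp => ?_
        have := hc p (Finset.mem_range.1 hp)
        gcongr
        exact pow_le_one₀ (norm_nonneg _) this
    _ = _ := by simp; ring

lemma lint_PP (N : ℕ) (c d : ℕ → ℂ) (hc : ∀ j < N, ‖c j‖ ≤ 1) (hd : ∀ j < N, ‖d j‖ ≤ 1) :
    (∫⁻ x in Set.Ioo (0:ℝ) (2 * π), ‖P N c x * (starRingEnd ℂ) (P N d x)‖ₑ) ≤ ENNReal.ofReal (2 * π * N) := by
  have hcc := P_cont N c
  have hcd := P_cont N d
  calc (∫⁻ x in Set.Ioo (0:ℝ) (2 * π), ‖P N c x * (starRingEnd ℂ) (P N d x)‖ₑ)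
      ≤ ∫⁻ x in Set.Ioo (0:ℝ) (2 * π), (ENNReal.ofReal (1/2) * ENNReal.ofReal (‖P N c x‖ ^ 2)
          + ENNReal.ofReal (1/2) * ENNReal.ofReal (‖P N d x‖ ^ 2)) := by
        refine lintegral_mono fun x => ?_
        rw [← ofReal_norm, ← ENNReal.ofReal_mul (by norm_num), ← ENNReal.ofReal_mul (by norm_num),
          ← ENNReal.ofReal_add (by positivity) (by positivity)]
        apply ENNReal.ofReal_le_ofReal
        rw [norm_mul, RCLike.norm_conj]
        nlinarith [sq_nonneg (‖P N c x‖ - ‖P N d x‖)]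
    _ ≤ ENNReal.ofReal (1/2) * ENNReal.ofReal (2 * π * N) + ENNReal.ofReal (1/2) * ENNReal.ofReal (2 * π * N) := by
        rw [lintegral_add_left (by fun_prop), lintegral_const_mul _ (by fun_prop), lintegral_const_mul _ (by fun_prop)]
        gcongr
        · exact lint_P_sq N c hc
        · exact lint_P_sq N d hd
    _ = _ := by
        rw [← ENNReal.ofReal_mul (by norm_num), ← ENNReal.ofReal_add (by positivity) (by positivity)]
        congr 1; ring

lemma P_shift (N : ℕ) (c : ℕ → ℂ) (x h : ℝ) :
    P N c (x + h) = P N (fun j => c j * Complex.exp (Complex.I * ((j * h : ℝ) : ℂ))) x := by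
  unfold P
  refine Finset.sum_congr rfl fun j _ => ?_
  rw [mul_assoc, ← Complex.exp_add]
  congr 2; push_cast; ring

lemma P_diff (N : ℕ) (c : ℕ → ℂ) (x h : ℝ) :
    P N c (x + h) - P N c x = P N (fun j => c j * (Complex.exp (Complex.I * ((j * h : ℝ) : ℂ)) - 1)) x := by
  rw [P_shift]
  unfold P
  rw [← Finset.sum_sub_distrib]
  exact Finset.sum_congr rfl fun j _ => by ring

lemma P_smul (N : ℕ) (c : ℕ → ℂ) (r : ℝ) (x : ℝ) : P N (fun j => r * c j) x = r * P N c x := by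
  unfold P
  rw [Finset.mul_sum]
  exact Finset.sum_congr rfl fun j _ => by ring

def G (N : ℕ) (c d : ℕ → ℂ) (x : ℝ) : ℂ := P N c x * (starRingEnd ℂ) (P N d x)

lemma G_cont (N : ℕ) (c d : ℕ → ℂ) : Continuous (G N c d) := by
  unfold G; have := P_cont N c; have := P_cont N d; fun_prop

lemma fwd_cont (k : ℕ) (h : ℝ) : ∀ g : ℝ → ℂ, Continuous g → Continuous ((fwdDiff h)^[k] g) := by
  induction k with
  | zero => intro g hg; simpa using hg
  | succ k ih =>
    intro g hg
    rw [Function.iterate_succ_apply]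
    exact ih _ (by unfold fwdDiff; fun_prop)

lemma lint_diff_G (N : ℕ) (h : ℝ) (k : ℕ) : ∀ (c d : ℕ → ℂ), (∀ j < N, ‖c j‖ ≤ 1) → (∀ j < N, ‖d j‖ ≤ 1) →
    (∫⁻ x in Set.Ioo (0:ℝ) (2 * π), ‖(fwdDiff h)^[k] (G N c d) x‖ₑ) ≤
      ENNReal.ofReal ((2 * min 2 (N * |h|)) ^ k * (2 * π * N)) := by
  induction k with
  | zero =>
    intro c d hc hd
    simpa [G] using lint_PP N c d hc hd
  | succ k ih =>
    intro c d hc hd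
    set τ : ℝ := min 2 (N * |h|) with hτ
    have hτ0 : 0 ≤ τ := by rw [hτ]; positivity
    have he : ∀ j < N, ‖Complex.exp (Complex.I * ((j * h : ℝ) : ℂ)) - 1‖ ≤ τ := by
      intro j hj
      apply le_min
      · refine (norm_sub_le _ _).trans ?_
        rw [mul_comm, Complex.norm_exp_ofReal_mul_I]; norm_num
      · refine Real.norm_exp_I_mul_ofReal_sub_one_le.trans ?_
        rw [Real.norm_eq_abs, abs_mul, Nat.abs_cast]
        gcongr
    set s : (ℕ → ℂ) → ℕ → ℂ := fun c j => c j * Complex.exp (Complex.I * ((j * h : ℝ) : ℂ)) with hs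
    set e : (ℕ → ℂ) → ℕ → ℂ := fun c j => ((τ⁻¹ : ℝ) : ℂ) * (c j * (Complex.exp (Complex.I * ((j * h : ℝ) : ℂ)) - 1)) with hee
    have hsb : ∀ c : ℕ → ℂ, (∀ j < N, ‖c j‖ ≤ 1) → ∀ j < N, ‖s c j‖ ≤ 1 := by
      intro c hc j hj
      simp only [hs]
      rw [norm_mul, mul_comm Complex.I, Complex.norm_exp_ofReal_mul_I, mul_one]
      exact hc j hj
    have heb : ∀ c : ℕ → ℂ, (∀ j < N, ‖c j‖ ≤ 1) → ∀ j < N, ‖e c j‖ ≤ 1 := by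
      intro c hc j hj
      simp only [hee]
      rw [norm_mul, norm_mul, Complex.norm_real, Real.norm_eq_abs, abs_of_nonneg (by positivity)]
      calc τ⁻¹ * (‖c j‖ * ‖Complex.exp (Complex.I * ((j * h : ℝ) : ℂ)) - 1‖) ≤ τ⁻¹ * (1 * τ) := by
            gcongr
            · exact hc j hj
            · exact he j hj
        _ ≤ 1 := by rw [one_mul]; exact inv_mul_le_one
    have hPe : ∀ (c : ℕ → ℂ) (x : ℝ), P N c (x + h) - P N c x = τ * P N (e c) x := by
      intro c x
      rw [P_diff, ← P_smul]
      unfold P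
      refine Finset.sum_congr rfl fun j hj => ?_
      simp only [hee]
      congr 1
      rcases eq_or_ne τ 0 with h0 | h0
      · have := he j (Finset.mem_range.1 hj)
        rw [h0] at this ⊢
        rw [norm_le_zero_iff.1 this]; simp
      · rw [← mul_assoc, ← Complex.ofReal_mul, mul_inv_cancel₀ h0]; simp
    have hG : fwdDiff h (G N c d) = (τ : ℂ) • (G N (e c) (s d) + G N c (e d)) := by
      ext x
      simp only [fwdDiff, G, Pi.smul_apply, Pi.add_apply, smul_eq_mul]
      have h1 := hPe c x
      have h2 := congrArg (starRingEnd ℂ) (hPe d x)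
      rw [map_sub, map_mul, Complex.conj_ofReal] at h2
      have h3 : P N (s d) x = P N d (x + h) := (P_shift N d x h).symm
      rw [h3]
      linear_combination (starRingEnd ℂ) (P N d (x + h)) * h1 + P N c x * h2
    rw [Function.iterate_succ_apply, hG, fwdDiff_iter_const_smul, fwdDiff_iter_add]
    have c1 := fwd_cont k h _ (G_cont N (e c) (s d))
    calc (∫⁻ x in Set.Ioo (0:ℝ) (2 * π), ‖((τ:ℂ) • ((fwdDiff h)^[k] (G N (e c) (s d)) + (fwdDiff h)^[k] (G N c (e d)))) x‖ₑ)
        ≤ ∫⁻ x in Set.Ioo (0:ℝ) (2 * π), ENNReal.ofReal τ * (‖(fwdDiff h)^[k] (G N (e c) (s d)) x‖ₑ + ‖(fwdDiff h)^[k] (G N c (e d)) x‖ₑ) := by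
          refine lintegral_mono fun x => ?_
          simp only [Pi.smul_apply, Pi.add_apply, smul_eq_mul]
          rw [enorm_mul]
          gcongr
          · rw [← ofReal_norm, Complex.norm_real, Real.norm_of_nonneg hτ0]
          · exact enorm_add_le _ _
      _ = ENNReal.ofReal τ * ((∫⁻ x in Set.Ioo (0:ℝ) (2 * π), ‖(fwdDiff h)^[k] (G N (e c) (s d)) x‖ₑ) +
            (∫⁻ x in Set.Ioo (0:ℝ) (2 * π), ‖(fwdDiff h)^[k] (G N c (e d)) x‖ₑ)) := by
          rw [lintegral_const_mul' _ _ ENNReal.ofReal_ne_top, lintegral_add_left (by fun_prop)]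
      _ ≤ ENNReal.ofReal τ * (ENNReal.ofReal ((2 * τ) ^ k * (2 * π * N)) + ENNReal.ofReal ((2 * τ) ^ k * (2 * π * N))) := by
          gcongr
          · exact ih _ _ (heb c hc) (hsb d hd)
          · exact ih _ _ hc (heb d hd)
      _ = _ := by
          rw [← ENNReal.ofReal_add (by positivity) (by positivity), ← ENNReal.ofReal_mul hτ0]
          congr 1; ring

lemma K_lower (N : ℕ) (x : ℝ) (hx0 : 0 ≤ x) (hx : x * N ≤ 1) : (N:ℝ) ^ 2 / 4 ≤ K N x := by
  have h1 : (N:ℝ) / 2 ≤ (P N (fun _ => 1) x).re := by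
    unfold P
    rw [Complex.re_sum]
    calc (N:ℝ)/2 = ∑ j ∈ Finset.range N, (1/2 : ℝ) := by simp; ring
      _ ≤ _ := by
        refine Finset.sum_le_sum fun j hj => ?_
        rw [one_mul, mul_comm Complex.I, Complex.exp_ofReal_mul_I_re]
        have hj' : (j:ℝ) ≤ N := by exact_mod_cast (Finset.mem_range.1 hj).le
        have h3 : (j:ℝ) * x ≤ 1 := by nlinarith
        have h4 : 0 ≤ (j:ℝ) * x := by positivity
        have := Real.one_sub_sq_div_two_le_cos (x := (j:ℝ) * x)
        nlinarith
  have h2 := (Complex.re_le_norm (P N (fun _ => 1) x))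
  unfold K
  have : (0:ℝ) ≤ (N:ℝ)/2 := by positivity
  nlinarith

lemma lint_K_lower (N : ℕ) (hN : 0 < N) (t : ℝ) :
    ENNReal.ofReal ((N:ℝ) ^ 2 / 4 * min t (1 / N)) ≤ ∫⁻ x in Set.Ioo (0:ℝ) t, ENNReal.ofReal (K N x) := by
  have hN' : (0:ℝ) < N := by exact_mod_cast hN
  calc ENNReal.ofReal ((N:ℝ) ^ 2 / 4 * min t (1 / N))
      = ∫⁻ x in Set.Ioo (0:ℝ) (min t (1/N)), ENNReal.ofReal ((N:ℝ) ^ 2 / 4) := by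
        rw [setLIntegral_const, Real.volume_Ioo, sub_zero, ENNReal.ofReal_mul (by positivity)]
    _ ≤ ∫⁻ x in Set.Ioo (0:ℝ) (min t (1/N)), ENNReal.ofReal (K N x) := by
        refine setLIntegral_mono' measurableSet_Ioo fun x hx => ENNReal.ofReal_le_ofReal (K_lower N x hx.1.le ?_)
        have := hx.2.le.trans (min_le_right _ _)
        rwa [le_div_iff₀ hN'] at this
    _ ≤ _ := lintegral_mono_set (Ioo_subset_Ioo_right (min_le_left _ _))

end S19
namespace S19

lemma coef_zero (u : ℝ → ℝ) (hu : IntegrableOn u (Set.Ioo 0 (2 * π)) volume)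
    (hc : ∀ j : ℕ, (∫ x in Set.Ioo (0:ℝ) (2 * π), u x * Real.cos (j * x)) = 0)
    (hs : ∀ j : ℕ, (∫ x in Set.Ioo (0:ℝ) (2 * π), u x * Real.sin (j * x)) = 0) (n : ℤ) :
    (∫ x in Set.Ioo (0:ℝ) (2 * π), Complex.exp (Complex.I * ((n * x : ℝ) : ℂ)) * (u x : ℂ)) = 0 := by
  have hc' : (∫ x in Set.Ioo (0:ℝ) (2 * π), u x * Real.cos (n * x)) = 0 := by
    obtain ⟨m, rfl | rfl⟩ := n.eq_nat_or_neg
    · simpa using hc m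
    · simpa using hc m
  have hs' : (∫ x in Set.Ioo (0:ℝ) (2 * π), u x * Real.sin (n * x)) = 0 := by
    obtain ⟨m, rfl | rfl⟩ := n.eq_nat_or_neg
    · simpa using hs m
    · simpa [integral_neg] using hs m
  have i1 : IntegrableOn (fun x => u x * Real.cos (n * x)) (Set.Ioo 0 (2 * π)) volume := by
    refine Integrable.mul_bdd (c := 1) hu (by fun_prop) (ae_of_all _ fun x => ?_)
    simpa using Real.abs_cos_le_one _
  have i2 : IntegrableOn (fun x => u x * Real.sin (n * x)) (Set.Ioo 0 (2 * π)) volume := by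
    refine Integrable.mul_bdd (c := 1) hu (by fun_prop) (ae_of_all _ fun x => ?_)
    simpa using Real.abs_sin_le_one _
  have e : ∀ x : ℝ, Complex.exp (Complex.I * ((n * x : ℝ) : ℂ)) * (u x : ℂ) =
      ((u x * Real.cos (n * x) : ℝ) : ℂ) + ((u x * Real.sin (n * x) : ℝ) : ℂ) * Complex.I := by
    intro x
    rw [mul_comm Complex.I, Complex.exp_mul_I, ← Complex.ofReal_cos, ← Complex.ofReal_sin]
    push_cast; ring
  simp_rw [e]
  rw [integral_add i1.ofReal (i2.ofReal.mul_const _), integral_mul_const,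
    integral_complex_ofReal, integral_complex_ofReal, hc', hs']
  simp

lemma uniq (u : ℝ → ℝ) (hu : IntegrableOn u (Set.Ioo 0 (2 * π)) volume)
    (hc : ∀ j : ℕ, (∫ x in Set.Ioo (0:ℝ) (2 * π), u x * Real.cos (j * x)) = 0)
    (hs : ∀ j : ℕ, (∫ x in Set.Ioo (0:ℝ) (2 * π), u x * Real.sin (j * x)) = 0) :
    ∀ᵐ x ∂(volume : Measure ℝ), x ∈ Set.Ioo (0:ℝ) (2 * π) → u x = 0 := by
  have : Fact (0 < 2 * π) := ⟨by positivity⟩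
  have hIntφ : ∀ φ : C(AddCircle (2 * π), ℂ), IntegrableOn (fun x : ℝ => φ (x : AddCircle (2 * π)) * (u x : ℂ))
      (Set.Ioo 0 (2 * π)) volume := by
    intro φ
    refine Integrable.bdd_mul (c := ‖φ‖) hu.ofReal ?_ (ae_of_all _ fun x => φ.norm_coe_le_norm _)
    have : Continuous (fun x : ℝ => φ (x : AddCircle (2 * π))) :=
      φ.continuous.comp (AddCircle.continuous_mk' _)
    exact this.aestronglyMeasurable
  let L : C(AddCircle (2 * π), ℂ) →ₗ[ℂ] ℂ :=
    { toFun := fun φ => ∫ x in Set.Ioo (0:ℝ) (2 * π), φ (x : AddCircle (2 * π)) * (u x : ℂ)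
      map_add' := by
        intro φ ψ
        rw [← integral_add (hIntφ φ) (hIntφ ψ)]
        congr 1; ext x; simp [add_mul]
      map_smul' := by
        intro c φ
        simp only [RingHom.id_apply, smul_eq_mul]
        rw [← integral_const_mul]
        congr 1; ext x; simp [mul_assoc] }
  let Λ := L.mkContinuous (∫ x in Set.Ioo (0:ℝ) (2 * π), ‖u x‖) (by
    intro φ
    refine (norm_integral_le_integral_norm _).trans ?_
    rw [← integral_mul_const]
    refine integral_mono (hIntφ φ).norm (hu.norm.mul_const _) fun x => ?_
    simp only [norm_mul, Complex.norm_real]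
    rw [mul_comm]
    gcongr
    exact φ.norm_coe_le_norm _)
  have hΛ : ∀ φ, Λ φ = 0 := by
    have h1 : Submodule.span ℂ (Set.range (@fourier (2 * π))) ≤ Λ.ker := by
      rw [Submodule.span_le]
      rintro _ ⟨n, rfl⟩
      simp only [SetLike.mem_coe, LinearMap.mem_ker]
      change (∫ x in Set.Ioo (0:ℝ) (2 * π), fourier n (x : AddCircle (2 * π)) * (u x : ℂ)) = 0
      rw [← coef_zero u hu hc hs n]
      congr 1; ext x
      rw [fourier_coe_apply]
      congr 2
      have : (π : ℂ) ≠ 0 := by exact_mod_cast Real.pi_ne_zero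
      push_cast
      field_simp
    have h2 := Submodule.topologicalClosure_minimal _ h1 Λ.isClosed_ker
    rw [span_fourier_closure_eq_top] at h2
    intro φ
    exact h2 (Submodule.mem_top)
  refine isOpen_Ioo.ae_eq_zero_of_integral_contDiff_smul_eq_zero hu.locallyIntegrableOn ?_
  intro g hg _ hgs
  have hg0 : ∀ x, x ∉ Set.Ioo (0:ℝ) (2 * π) → g x = 0 := by
    intro x hx
    by_contra h
    exact hx (hgs (subset_tsupport _ h))
  have hcont : Continuous (AddCircle.liftIco (2 * π) 0 (fun x => (g x : ℂ))) := by
    apply AddCircle.liftIco_continuous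
    · rw [hg0 0 (by simp), hg0 (0 + 2 * π) (by simp)]
    · have := hg.continuous
      fun_prop
  have h3 := hΛ ⟨_, hcont⟩
  change (∫ x in Set.Ioo (0:ℝ) (2 * π), AddCircle.liftIco (2 * π) 0 (fun x => (g x : ℂ)) (x : AddCircle (2 * π)) * (u x : ℂ)) = 0 at h3
  have h4 : (∫ x in Set.Ioo (0:ℝ) (2 * π), AddCircle.liftIco (2 * π) 0 (fun x => (g x : ℂ)) (x : AddCircle (2 * π)) * (u x : ℂ))
     = ∫ x in Set.Ioo (0:ℝ) (2 * π), ((g x • u x : ℝ) : ℂ) := by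
    refine setIntegral_congr_fun measurableSet_Ioo fun x hx => ?_
    rw [AddCircle.liftIco_coe_apply (by simpa using ⟨hx.1.le, hx.2⟩)]
    simp
  rw [h4, integral_complex_ofReal, Complex.ofReal_eq_zero] at h3
  rw [← h3, eq_comm]
  apply setIntegral_eq_integral_of_forall_compl_eq_zero
  intro x hx
  rw [hg0 x hx, zero_smul]

lemma riemLeb (f : ℝ → ℝ) (hf : IntegrableOn f (Set.Ioo 0 (2 * π)) volume) :
    Tendsto (fun n : ℕ => ∫ x in Set.Ioo (0:ℝ) (2 * π), f x * Real.cos (n * x)) atTop (nhds 0) := by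
  have h := Real.tendsto_integral_exp_smul_cocompact ((Set.Ioo (0:ℝ) (2 * π)).indicator (fun x => (f x : ℂ)))
  have h2 : Tendsto (fun n : ℕ => (n:ℝ) / (2 * π)) atTop (cocompact ℝ) :=
    (tendsto_natCast_atTop_atTop.atTop_div_const (by positivity)).mono_right atTop_le_cocompact
  have h3 := (Complex.continuous_re.tendsto 0).comp (h.comp h2)
  rw [Complex.zero_re] at h3
  refine h3.congr fun n => ?_
  simp only [Function.comp]
  have e : (fun v : ℝ => (Real.fourierChar (-(v * ((n:ℝ) / (2 * π))))) • (Set.Ioo (0:ℝ) (2 * π)).indicator (fun x => (f x : ℂ)) v)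
    = (Set.Ioo (0:ℝ) (2 * π)).indicator (fun v => Complex.exp (((-(n * v) : ℝ) : ℂ) * Complex.I) * (f v : ℂ)) := by
    ext v
    by_cases hv : v ∈ Set.Ioo (0:ℝ) (2 * π)
    · rw [indicator_of_mem hv, indicator_of_mem hv, Circle.smul_def, Real.fourierChar_apply, smul_eq_mul]
      congr 4
      field_simp
    · rw [indicator_of_notMem hv, indicator_of_notMem hv, smul_zero]
  rw [e, integral_indicator measurableSet_Ioo]
  have hi : IntegrableOn (fun v : ℝ => Complex.exp (((-(n * v) : ℝ) : ℂ) * Complex.I) * (f v : ℂ)) (Set.Ioo (0:ℝ) (2 * π)) volume := by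
    refine Integrable.bdd_mul (c := 1) hf.ofReal (by fun_prop) (ae_of_all _ fun x => ?_)
    rw [Complex.norm_exp_ofReal_mul_I]
  have := integral_re (𝕜 := ℂ) hi
  simp only [RCLike.re_eq_complex_re] at this
  rw [← this]
  congr 1; ext x
  rw [mul_comm, Complex.re_ofReal_mul, Complex.exp_ofReal_mul_I_re, Real.cos_neg]

end S19
namespace S19

lemma le_rearrR (f : ℝ → ℝ) (s l : ℝ) (hl : 0 ≤ l)
    (h : ENNReal.ofReal s < torusMeasure {x | l < |f x|}) :
    ENNReal.ofReal l ≤ rearrR torusMeasure f s := by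
  unfold rearrR rearr
  refine le_sInf fun m hm => ?_
  by_contra! hlt
  refine absurd (h.trans_le ((measure_mono ?_).trans hm)) (lt_irrefl _)
  intro x hx
  simp only [mem_ofPred_eq] at hx ⊢
  exact hlt.trans ((ENNReal.ofReal_lt_ofReal_iff (hl.trans_lt hx)).2 hx)

lemma rearrR_anti (f : ℝ → ℝ) : Antitone (rearrR torusMeasure f) := by
  intro s t hst
  unfold rearrR rearr
  refine sInf_le_sInf fun l hl => ?_
  exact le_trans hl (ENNReal.ofReal_le_ofReal hst)

lemma rearrR_ne_top (f : ℝ → ℝ) (hfm : Measurable f)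
    (hfint : IntegrableOn f (Set.Ioo 0 (2 * π)) volume) (s : ℝ) (hs : 0 < s) :
    rearrR torusMeasure f s ≠ ∞ := by
  have hI : (∫⁻ x, ENNReal.ofReal |f x| ∂torusMeasure) ≠ ∞ := by
    have := hfint.2
    rw [hasFiniteIntegral_iff_norm] at this
    exact this.ne
  set I := ∫⁻ x, ENNReal.ofReal |f x| ∂torusMeasure with hIdef
  have hs' : ENNReal.ofReal s ≠ 0 := by simpa using hs
  have hε : I / ENNReal.ofReal s + 1 ≠ ∞ := ENNReal.add_ne_top.2 ⟨ENNReal.div_ne_top hI hs', by simp⟩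
  refine ne_top_of_le_ne_top hε (sInf_le ?_)
  simp only [mem_ofPred_eq]
  refine (measure_mono (t := {x | I / ENNReal.ofReal s + 1 ≤ ENNReal.ofReal |f x|}) fun x hx => by
    simp only [mem_ofPred_eq] at hx ⊢; exact hx.le).trans ?_
  refine (meas_ge_le_lintegral_div (by fun_prop) (by simp) hε).trans ?_
  refine ENNReal.div_le_of_le_mul ?_
  rw [mul_add, ENNReal.mul_div_cancel hs' ENNReal.ofReal_ne_top]
  exact le_self_add

lemma torus_fin (A : Set ℝ) : torusMeasure A ≠ ∞ := by
  have : IsFiniteMeasure torusMeasure := by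
    unfold torusMeasure
    infer_instance
  exact measure_ne_top _ _

lemma int_le_rearr (f : ℝ → ℝ) (hfm : Measurable f)
    (hfint : IntegrableOn f (Set.Ioo 0 (2 * π)) volume) (t : ℝ) (ht0 : 0 < t) (ht : t < 1) :
    (∫⁻ x in Set.Ioo (0:ℝ) t, ENNReal.ofReal |f x|) ≤ ∫⁻ s in Set.Ioo (0:ℝ) t, rearrR torusMeasure f s := by
  have hpi := Real.pi_gt_three
  have hmeas : Measurable (rearrR torusMeasure f) := (rearrR_anti f).measurable
  have e : (∫⁻ s in Set.Ioo (0:ℝ) t, rearrR torusMeasure f s) =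
      ∫⁻ s in Set.Ioo (0:ℝ) t, ENNReal.ofReal (rearrR torusMeasure f s).toReal := by
    refine setLIntegral_congr_fun measurableSet_Ioo fun s hs => ?_
    exact (ENNReal.ofReal_toReal (rearrR_ne_top f hfm hfint s hs.1)).symm
  rw [e, lintegral_eq_lintegral_meas_le _ (ae_of_all _ fun x => ENNReal.toReal_nonneg) (by fun_prop),
    lintegral_eq_lintegral_meas_lt _ (ae_of_all _ fun x => abs_nonneg _) (by fun_prop)]
  refine setLIntegral_mono' measurableSet_Ioi fun l hl => ?_
  have hl0 : (0:ℝ) ≤ l := le_of_lt hl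
  set m := (torusMeasure {x | l < |f x|}).toReal with hm
  have hmm : ENNReal.ofReal m = torusMeasure {x | l < |f x|} := ENNReal.ofReal_toReal (torus_fin _)
  calc (volume.restrict (Set.Ioo 0 t)) {x | l < |f x|} ≤ min (ENNReal.ofReal t) (ENNReal.ofReal m) := by
        apply le_min
        · refine (measure_mono (subset_univ _)).trans ?_
          simp
        · rw [hmm]
          exact Measure.restrict_mono (Ioo_subset_Ioo_right (by linarith)) le_rfl _
    _ = ENNReal.ofReal (min t m) := (ENNReal.ofReal_mono.map_min).symm
    _ = volume.restrict (Set.Ioo 0 t) (Set.Ioo 0 (min t m)) := by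
        rw [Measure.restrict_apply measurableSet_Ioo,
          inter_eq_left.2 (Ioo_subset_Ioo_right (min_le_left _ _)), Real.volume_Ioo, sub_zero]
    _ ≤ _ := by
        refine measure_mono fun s hs => ?_
        simp only [mem_ofPred_eq]
        have h1 : ENNReal.ofReal s < torusMeasure {x | l < |f x|} := by
          rw [← hmm]
          have : s < m := hs.2.trans_le (min_le_right _ _)
          exact (ENNReal.ofReal_lt_ofReal_iff (hs.1.trans this)).2 this
        have := le_rearrR f s l hl0 h1
        exact (ENNReal.ofReal_le_iff_le_toReal (rearrR_ne_top f hfm hfint s hs.1)).1 this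

lemma rearr_lower (f : ℝ → ℝ) (hf : ¬ (f =ᵐ[torusMeasure] 0)) :
    ∃ c : ℝ, 0 < c ∧ ∀ t ∈ Set.Ioo (0:ℝ) 1,
      ENNReal.ofReal (c * t) ≤ ∫⁻ s in Set.Ioo (0:ℝ) t, rearrR torusMeasure f s := by
  have : ∃ n : ℕ, torusMeasure {x | 1 / ((n:ℝ) + 1) < |f x|} ≠ 0 := by
    by_contra! hcon
    apply hf
    have h1 := measure_iUnion_null hcon
    rw [Filter.EventuallyEq, ae_iff]
    refine measure_mono_null (fun x hx => ?_) h1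
    simp only [mem_ofPred_eq, Pi.zero_apply] at hx
    obtain ⟨n, hn⟩ := exists_nat_one_div_lt (abs_pos.2 hx)
    exact mem_iUnion.2 ⟨n, hn⟩
  obtain ⟨n, hn⟩ := this
  set l : ℝ := 1 / ((n:ℝ) + 1) with hl
  have hl0 : 0 < l := by positivity
  set m := (torusMeasure {x | l < |f x|}).toReal with hm
  have hmm : ENNReal.ofReal m = torusMeasure {x | l < |f x|} := ENNReal.ofReal_toReal (torus_fin _)
  have hm0 : 0 < m := ENNReal.toReal_pos hn (torus_fin _)
  refine ⟨l * min 1 m, by positivity, fun t ht => ?_⟩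
  calc ENNReal.ofReal (l * min 1 m * t) ≤ ENNReal.ofReal (l * min t m) := by
        apply ENNReal.ofReal_le_ofReal
        rw [mul_assoc]
        gcongr
        apply le_min
        · have := min_le_left 1 m
          nlinarith [ht.1]
        · have := min_le_right 1 m
          have h2 : 0 < min 1 m := by positivity
          nlinarith [ht.1, ht.2]
    _ = ∫⁻ s in Set.Ioo (0:ℝ) (min t m), ENNReal.ofReal l := by
        rw [setLIntegral_const, Real.volume_Ioo, sub_zero, ENNReal.ofReal_mul (by positivity)]
    _ ≤ ∫⁻ s in Set.Ioo (0:ℝ) (min t m), rearrR torusMeasure f s := by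
        refine setLIntegral_mono' measurableSet_Ioo fun s hs => ?_
        refine le_rearrR f s l hl0.le ?_
        rw [← hmm]
        have : s < m := hs.2.trans_le (min_le_right _ _)
        exact (ENNReal.ofReal_lt_ofReal_iff (hs.1.trans this)).2 this
    _ ≤ _ := lintegral_mono_set (Ioo_subset_Ioo_right (min_le_left _ _))

end S19
namespace S19

/-- second differences of the coefficients -/
def w (a : ℕ → ℝ) (N : ℕ) : ℝ := if 2 ≤ N then a (N - 1) - 2 * a N + a (N + 1) else 0

lemma w_nonneg (a : ℕ → ℝ) (hconv : ∀ n : ℕ, 1 ≤ n → 0 ≤ a n - 2 * a (n + 1) + a (n + 2)) (N : ℕ) :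
    0 ≤ w a N := by
  unfold w
  split_ifs with h
  · have := hconv (N - 1) (by omega)
    rwa [show N - 1 + 1 = N by omega, show N - 1 + 2 = N + 1 by omega] at this
  · exact le_rfl

lemma d_bound (a : ℕ → ℝ) (hconv : ∀ n : ℕ, 1 ≤ n → 0 ≤ a n - 2 * a (n + 1) + a (n + 2))
    (r : ℕ) (hr : 1 ≤ r) (p : ℕ) : (p:ℝ) * (a (r + p) - a (r + p + 1)) ≤ a r - a (r + p) := by
  induction p with
  | zero => simp
  | succ p ih =>
    have h := hconv (r + p) (by omega)
    have e1 : r + (p + 1) = r + p + 1 := by ring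
    have e2 : r + p + 2 = r + p + 1 + 1 := by ring
    rw [e1]; rw [e2] at h
    push_cast
    nlinarith [(Nat.cast_nonneg p : (0:ℝ) ≤ p)]

lemma partial_w (a : ℕ → ℝ) (j : ℕ) (hj : 1 ≤ j) (m : ℕ) :
    ∑ N ∈ Finset.range (m + (j + 1)), w a N * ((N - j : ℕ) : ℝ) =
      a j - a (j + m) - m * (a (j + m) - a (j + m + 1)) := by
  induction m with
  | zero =>
    simp only [zero_add, add_zero, sub_self, Nat.cast_zero, zero_mul]
    refine Finset.sum_eq_zero fun N hN => ?_
    have : N - j = 0 := by have := Finset.mem_range.1 hN; omega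
    rw [this]; simp
  | succ m ih =>
    rw [show m + 1 + (j + 1) = (m + (j + 1)) + 1 by ring, Finset.sum_range_succ, ih]
    unfold w
    rw [if_pos (by omega), show m + (j + 1) - 1 = j + m by omega, show m + (j + 1) - j = m + 1 by omega,
      show m + (j + 1) = j + m + 1 by ring, show j + (m + 1) = j + m + 1 by ring]
    push_cast; ring

lemma a_nonneg (a : ℕ → ℝ) (hdec : ∀ n : ℕ, 1 ≤ n → a (n + 1) ≤ a n)
    (h0 : Tendsto a atTop (nhds 0)) (j : ℕ) (hj : 1 ≤ j) : 0 ≤ a j := by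
  refine le_of_tendsto h0 ?_
  filter_upwards [eventually_ge_atTop j] with n hn
  induction n, hn using Nat.le_induction with
  | base => exact le_rfl
  | succ n hn ih => exact (hdec n (by omega)).trans ih

lemma w_hasSum (a : ℕ → ℝ) (hdec : ∀ n : ℕ, 1 ≤ n → a (n + 1) ≤ a n)
    (hconv : ∀ n : ℕ, 1 ≤ n → 0 ≤ a n - 2 * a (n + 1) + a (n + 2))
    (h0 : Tendsto a atTop (nhds 0)) (j : ℕ) (hj : 1 ≤ j) :
    HasSum (fun N => w a N * ((N - j : ℕ) : ℝ)) (a j) := by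
  rw [hasSum_iff_tendsto_nat_of_nonneg (fun N => mul_nonneg (w_nonneg a hconv N) (Nat.cast_nonneg _)),
    ← tendsto_add_atTop_iff_nat (j + 1)]
  simp_rw [partial_w a j hj]
  have t1 : Tendsto (fun m => a (j + m)) atTop (nhds 0) :=
    h0.comp (tendsto_atTop_mono (fun m => Nat.le_add_left m j) tendsto_id)
  have t2 : Tendsto (fun m : ℕ => (m:ℝ) * (a (j + m) - a (j + m + 1))) atTop (nhds 0) := by
    have t3 : Tendsto (fun m : ℕ => 2 * a (j + m / 2)) atTop (nhds 0) := by
      have : Tendsto (fun m : ℕ => m / 2) atTop atTop := Nat.tendsto_div_const_atTop (by norm_num)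
      simpa using (t1.comp this).const_mul 2
    refine squeeze_zero (fun m => ?_) (fun m => ?_) t3
    · exact mul_nonneg (Nat.cast_nonneg _) (sub_nonneg.2 (hdec _ (by omega)))
    · have h := d_bound a hconv (j + m / 2) (by omega) (m - m / 2)
      rw [show j + m / 2 + (m - m / 2) = j + m by omega] at h
      have hd := sub_nonneg.2 (hdec (j + m) (by omega))
      have ha := a_nonneg a hdec h0 (j + m) (by omega)
      have hm : (m:ℝ) ≤ 2 * ((m - m / 2 : ℕ) : ℝ) := by
        have : m ≤ 2 * (m - m / 2) := by omega
        exact_mod_cast this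
      nlinarith
  simpa using (t1.const_sub (a j)).sub t2

lemma w_summable (a : ℕ → ℝ) (hdec : ∀ n : ℕ, 1 ≤ n → a (n + 1) ≤ a n)
    (hconv : ∀ n : ℕ, 1 ≤ n → 0 ≤ a n - 2 * a (n + 1) + a (n + 2))
    (h0 : Tendsto a atTop (nhds 0)) : Summable (fun N => w a N * (N : ℝ)) := by
  refine Summable.of_nonneg_of_le (fun N => mul_nonneg (w_nonneg a hconv N) (Nat.cast_nonneg _)) (fun N => ?_)
    ((w_hasSum a hdec hconv h0 1 le_rfl).summable.mul_left 2)
  by_cases hN : 2 ≤ N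
  · have : (N:ℝ) ≤ 2 * ((N - 1 : ℕ) : ℝ) := by
      have : N ≤ 2 * (N - 1) := by omega
      exact_mod_cast this
    nlinarith [w_nonneg a hconv N]
  · simp [w, hN]

lemma bern (m : ℝ) (hm : 0 ≤ m) (p : ℕ) : (m + 1) ^ (p + 1) - m ^ (p + 1) ≤ (p + 1) * (m + 1) ^ p := by
  induction p with
  | zero => simp
  | succ p ih =>
    have h1 : m ^ (p + 1) ≤ (m + 1) ^ (p + 1) := by gcongr; linarith
    have e : (m + 1) ^ (p + 1 + 1) - m ^ (p + 1 + 1) = (m + 1) * ((m + 1) ^ (p + 1) - m ^ (p + 1)) + m ^ (p + 1) := by ring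
    rw [e]
    have : (m + 1) * ((m + 1) ^ (p + 1) - m ^ (p + 1)) ≤ (m + 1) * ((p + 1) * (m + 1) ^ p) := by gcongr
    push_cast
    calc _ ≤ (m + 1) * ((p + 1) * (m + 1) ^ p) + (m + 1) ^ (p + 1) := by linarith
      _ = _ := by ring

lemma S_bound (q L : ℕ) : (L:ℝ) ^ (q + 1) ≤ (q + 1) * ∑ i ∈ Finset.range L, ((i:ℝ) + 1) ^ q := by
  induction L with
  | zero => simp
  | succ L ih =>
    rw [Finset.sum_range_succ, mul_add]
    have := bern (L:ℝ) (Nat.cast_nonneg _) q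
    push_cast
    linarith

lemma T_bound (q L : ℕ) : (L:ℝ) ^ (q + 2) ≤
    (q + 2) * (q + 1) * ∑ i ∈ Finset.range L, ((L - i : ℕ) : ℝ) * ((i:ℝ) + 1) ^ q := by
  induction L with
  | zero => simp
  | succ L ih =>
    have e : ∑ i ∈ Finset.range (L + 1), ((L + 1 - i : ℕ) : ℝ) * ((i:ℝ) + 1) ^ q =
        (∑ i ∈ Finset.range L, ((L - i : ℕ) : ℝ) * ((i:ℝ) + 1) ^ q) + ∑ i ∈ Finset.range (L + 1), ((i:ℝ) + 1) ^ q := by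
      rw [Finset.sum_range_succ, Finset.sum_range_succ (fun i : ℕ => ((i:ℝ) + 1) ^ q), ← add_assoc,
        ← Finset.sum_add_distrib]
      congr 1
      · refine Finset.sum_congr rfl fun i hi => ?_
        have := Finset.mem_range.1 hi
        rw [show L + 1 - i = (L - i) + 1 by omega]
        push_cast; ring
      · simp
    rw [e, mul_add]
    have h1 := bern (L:ℝ) (Nat.cast_nonneg _) (q + 1)
    have h2 := S_bound q (L + 1)
    push_cast at h1 h2 ⊢
    have h3 : ((q:ℝ) + 2) * ((L:ℝ) + 1) ^ (q + 1) ≤ (q + 2) * ((q + 1) * ∑ i ∈ Finset.range (L + 1), ((i:ℝ) + 1) ^ q) := by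
      gcongr
    have e3 : (q:ℝ) + 1 + 1 = q + 2 := by ring
    rw [e3] at h1
    rw [show q + 1 + 1 = q + 2 by ring] at h1
    nlinarith

lemma rpow_sum (ε : ℝ) (hε : 0 < ε) : ∃ B : ℝ, 0 < B ∧ ∀ L : ℕ,
    ∑ i ∈ Finset.range L, ((i:ℝ) + 1) ^ (ε - 1) ≤ B * (L:ℝ) ^ ε := by
  rcases le_total 1 ε with h | h
  · refine ⟨1, one_pos, fun L => ?_⟩
    rcases Nat.eq_zero_or_pos L with rfl | hL
    · simp; positivity
    have hL' : (0:ℝ) < L := by exact_mod_cast hL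
    calc ∑ i ∈ Finset.range L, ((i:ℝ) + 1) ^ (ε - 1) ≤ ∑ i ∈ Finset.range L, (L:ℝ) ^ (ε - 1) := by
          refine Finset.sum_le_sum fun i hi => ?_
          refine Real.rpow_le_rpow (by positivity) ?_ (by linarith)
          exact_mod_cast Finset.mem_range.1 hi
      _ = 1 * (L:ℝ) ^ ε := by
          rw [Finset.sum_const, Finset.card_range, nsmul_eq_mul, Real.rpow_sub_one hL'.ne']
          field_simp
  · refine ⟨1 / ε, by positivity, fun L => ?_⟩
    induction L with
    | zero => simp; positivity
    | succ L ih =>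
      rw [Finset.sum_range_succ]
      have hx : (0:ℝ) < (L:ℝ) + 1 := by positivity
      have h1 := rpow_one_add_le_one_add_mul_self (s := -(1 / ((L:ℝ) + 1)))
        (by rw [neg_le_neg_iff, div_le_one hx]; linarith [(Nat.cast_nonneg L : (0:ℝ) ≤ L)]) hε.le h
      have h2 : (L:ℝ) ^ ε = ((L:ℝ) + 1) ^ ε * (1 + -(1 / ((L:ℝ) + 1))) ^ ε := by
        have h3 : (1 + -(1 / ((L:ℝ) + 1))) = L / (L + 1) := by field_simp; ring
        rw [h3, ← Real.mul_rpow (by positivity) (by positivity)]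
        congr 1; field_simp
      have h4 : (L:ℝ) ^ ε ≤ ((L:ℝ) + 1) ^ ε * (1 + ε * -(1 / ((L:ℝ) + 1))) := by
        rw [h2]; gcongr
      have h5 : ((L:ℝ) + 1) ^ (ε - 1) = ((L:ℝ) + 1) ^ ε / ((L:ℝ) + 1) := Real.rpow_sub_one hx.ne' _
      rw [h5]
      push_cast
      have h6 : 1 / ε * (L:ℝ) ^ ε ≤ 1 / ε * (((L:ℝ) + 1) ^ ε * (1 + ε * -(1 / ((L:ℝ) + 1)))) := by gcongr
      have h7 : 1 / ε * (((L:ℝ) + 1) ^ ε * (1 + ε * -(1 / ((L:ℝ) + 1)))) =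
         1 / ε * ((L:ℝ) + 1) ^ ε - ((L:ℝ) + 1) ^ ε / ((L:ℝ) + 1) := by field_simp; ring
      linarith

lemma sum_low (k : ℕ) (hk0 : 0 < k) (a : ℕ → ℝ) (hdec : ∀ n : ℕ, 1 ≤ n → a (n + 1) ≤ a n)
    (hconv : ∀ n : ℕ, 1 ≤ n → 0 ≤ a n - 2 * a (n + 1) + a (n + 2))
    (h0 : Tendsto a atTop (nhds 0))
    (hgrowth : ∃ ε C : ℝ, 0 < ε ∧ 0 < C ∧ ∀ n m : ℕ, 1 ≤ n → n ≤ m →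
      a n * (n : ℝ) ^ ((k : ℝ) - ε) ≤ C * (a m * (m : ℝ) ^ ((k : ℝ) - ε))) :
    ∃ A : ℝ, 0 < A ∧ ∀ M : ℕ, 1 ≤ M → ∑ N ∈ Finset.range M, w a N * (N:ℝ) ^ (k + 1) ≤ A * (a M * (M:ℝ) ^ k) := by
  obtain ⟨ε, C, hε, hC, hg⟩ := hgrowth
  obtain ⟨B, hB, hBs⟩ := rpow_sum ε hε
  obtain ⟨q, rfl⟩ : ∃ q, k = q + 1 := ⟨k - 1, by omega⟩
  set C1 : ℝ := 2 ^ (q + 2) * ((q + 2) * (q + 1)) with hC1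
  refine ⟨C1 * (C * B), by positivity, fun M hM => ?_⟩
  have hM' : (0:ℝ) < M := by exact_mod_cast hM
  have haM := a_nonneg a hdec h0 M hM
  have step1 : ∀ N ∈ Finset.range M, w a N * (N:ℝ) ^ (q + 1 + 1) ≤
      C1 * ∑ i ∈ Finset.range (M - 1), (w a N * ((N - (i + 1) : ℕ) : ℝ)) * ((i:ℝ) + 1) ^ q := by
    intro N hN
    by_cases h2 : 2 ≤ N
    · have hw := w_nonneg a hconv N
      have hT := T_bound q (N - 1)
      have hle : (N:ℝ) ≤ 2 * ((N - 1 : ℕ) : ℝ) := by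
        have : N ≤ 2 * (N - 1) := by omega
        exact_mod_cast this
      have hsub : ∑ i ∈ Finset.range (N - 1), ((N - 1 - i : ℕ) : ℝ) * ((i:ℝ) + 1) ^ q ≤
          ∑ i ∈ Finset.range (M - 1), ((N - (i + 1) : ℕ) : ℝ) * ((i:ℝ) + 1) ^ q := by
        simp_rw [show ∀ i, N - 1 - i = N - (i + 1) by intro i; omega]
        refine Finset.sum_le_sum_of_subset_of_nonneg ?_ (fun i _ _ => by positivity)
        have := Finset.mem_range.1 hN
        exact Finset.range_mono (by omega)
      calc w a N * (N:ℝ) ^ (q + 1 + 1) ≤ w a N * (2 * ((N - 1 : ℕ) : ℝ)) ^ (q + 2) := by gcongr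
        _ = w a N * (2 ^ (q + 2) * ((N - 1 : ℕ) : ℝ) ^ (q + 2)) := by rw [mul_pow]
        _ ≤ w a N * (2 ^ (q + 2) * ((q + 2) * (q + 1) * ∑ i ∈ Finset.range (M - 1), ((N - (i + 1) : ℕ) : ℝ) * ((i:ℝ) + 1) ^ q)) := by
            gcongr
            refine hT.trans ?_
            gcongr
        _ = C1 * (w a N * ∑ i ∈ Finset.range (M - 1), ((N - (i + 1) : ℕ) : ℝ) * ((i:ℝ) + 1) ^ q) := by
            rw [hC1]; ring
        _ = _ := by
            rw [Finset.mul_sum]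
            simp_rw [mul_assoc]
    · simp [w, h2]
  calc ∑ N ∈ Finset.range M, w a N * (N:ℝ) ^ (q + 1 + 1)
      ≤ ∑ N ∈ Finset.range M, C1 * ∑ i ∈ Finset.range (M - 1), (w a N * ((N - (i + 1) : ℕ) : ℝ)) * ((i:ℝ) + 1) ^ q :=
        Finset.sum_le_sum step1
    _ = C1 * ∑ i ∈ Finset.range (M - 1), (∑ N ∈ Finset.range M, w a N * ((N - (i + 1) : ℕ) : ℝ)) * ((i:ℝ) + 1) ^ q := by
        rw [← Finset.mul_sum, Finset.sum_comm]
        simp_rw [Finset.sum_mul]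
    _ ≤ C1 * ∑ i ∈ Finset.range (M - 1), C * (a M * (M:ℝ) ^ (((q + 1 : ℕ) : ℝ) - ε)) * ((i:ℝ) + 1) ^ (ε - 1) := by
        refine mul_le_mul_of_nonneg_left (Finset.sum_le_sum fun i hi => ?_) (by positivity)
        have hi' := Finset.mem_range.1 hi
        have h1 : ∑ N ∈ Finset.range M, w a N * ((N - (i + 1) : ℕ) : ℝ) ≤ a (i + 1) :=
          sum_le_hasSum _ (fun N _ => mul_nonneg (w_nonneg a hconv N) (Nat.cast_nonneg _))
            (w_hasSum a hdec hconv h0 (i + 1) (by omega))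
        have h2 := hg (i + 1) M (by omega) (by omega)
        have h3 : ((i:ℝ) + 1) ^ q = ((i + 1 : ℕ) : ℝ) ^ (((q + 1 : ℕ) : ℝ) - ε) * ((i:ℝ) + 1) ^ (ε - 1) := by
          push_cast
          rw [← Real.rpow_add (by positivity), ← Real.rpow_natCast]
          congr 1; ring
        calc (∑ N ∈ Finset.range M, w a N * ((N - (i + 1) : ℕ) : ℝ)) * ((i:ℝ) + 1) ^ q ≤ a (i + 1) * ((i:ℝ) + 1) ^ q := by gcongr
          _ = (a (i + 1) * ((i + 1 : ℕ) : ℝ) ^ (((q + 1 : ℕ) : ℝ) - ε)) * ((i:ℝ) + 1) ^ (ε - 1) := by rw [h3]; ring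
          _ ≤ _ := by gcongr
    _ = C1 * (C * (a M * (M:ℝ) ^ (((q + 1 : ℕ) : ℝ) - ε)) * ∑ i ∈ Finset.range (M - 1), ((i:ℝ) + 1) ^ (ε - 1)) := by
        rw [← Finset.mul_sum]
    _ ≤ C1 * (C * (a M * (M:ℝ) ^ (((q + 1 : ℕ) : ℝ) - ε)) * (B * (M:ℝ) ^ ε)) := by
        gcongr
        refine (hBs (M - 1)).trans ?_
        gcongr
        exact Nat.sub_le _ _
    _ = C1 * (C * B) * (a M * ((M:ℝ) ^ (((q + 1 : ℕ) : ℝ) - ε) * (M:ℝ) ^ ε)) := by ring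
    _ = _ := by
        rw [← Real.rpow_add hM', sub_add_cancel, Real.rpow_natCast]

lemma numeric (k : ℕ) (hk0 : 0 < k) (a : ℕ → ℝ) (hdec : ∀ n : ℕ, 1 ≤ n → a (n + 1) ≤ a n)
    (hconv : ∀ n : ℕ, 1 ≤ n → 0 ≤ a n - 2 * a (n + 1) + a (n + 2))
    (h0 : Tendsto a atTop (nhds 0))
    (hgrowth : ∃ ε C : ℝ, 0 < ε ∧ 0 < C ∧ ∀ n m : ℕ, 1 ≤ n → n ≤ m →
      a n * (n : ℝ) ^ ((k : ℝ) - ε) ≤ C * (a m * (m : ℝ) ^ ((k : ℝ) - ε))) :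
    ∃ A : ℝ, 0 < A ∧ ∀ t ∈ Set.Ioo (0:ℝ) 1,
      Summable (fun N : ℕ => w a N * (N * (min 2 (N * t)) ^ k)) ∧
      Summable (fun N : ℕ => w a N * ((N:ℝ) ^ 2 * min t (1 / N))) ∧
      ∑' N : ℕ, w a N * (N * (min 2 (N * t)) ^ k) ≤ A * ∑' N : ℕ, w a N * ((N:ℝ) ^ 2 * min t (1 / N)) := by
  obtain ⟨A, hA, hlow⟩ := sum_low k hk0 a hdec hconv h0 hgrowth
  refine ⟨2 ^ k + A * 2 ^ k, by positivity, fun t ht => ?_⟩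
  obtain ⟨ht0, ht1⟩ := ht
  have hw := w_nonneg a hconv
  have hws := w_summable a hdec hconv h0
  have s1 : Summable (fun N : ℕ => w a N * (N * (min 2 (N * t)) ^ k)) := by
    refine Summable.of_nonneg_of_le (fun N => ?_) (fun N => ?_) (hws.mul_right (2 ^ k))
    · have := hw N; positivity
    · rw [← mul_assoc]
      have := hw N
      gcongr
      exact min_le_left _ _
  have hlt : ∀ N : ℕ, (N:ℝ) ^ 2 * min t (1 / N) ≤ N := by
    intro N
    rcases Nat.eq_zero_or_pos N with rfl | hN
    · simp
    have hN' : (0:ℝ) < N := by exact_mod_cast hN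
    calc (N:ℝ) ^ 2 * min t (1 / (N:ℝ)) ≤ (N:ℝ) ^ 2 * (1 / (N:ℝ)) := by gcongr; exact min_le_right _ _
      _ = (N:ℝ) := by field_simp
  have hs0 : ∀ N : ℕ, 0 ≤ w a N * ((N:ℝ) ^ 2 * min t (1 / N)) := by
    intro N
    have := hw N
    have : (0:ℝ) ≤ 1 / N := by positivity
    positivity
  have s2 : Summable (fun N : ℕ => w a N * ((N:ℝ) ^ 2 * min t (1 / N))) := by
    refine Summable.of_nonneg_of_le hs0 (fun N => ?_) hws
    exact mul_le_mul_of_nonneg_left (hlt N) (hw N)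
  refine ⟨s1, s2, ?_⟩
  have heq : ∀ N : ℕ, 1 / t ≤ N → (N:ℝ) ^ 2 * min t (1 / N) = N := by
    intro N hN
    have hN' : (0:ℝ) < N := lt_of_lt_of_le (by positivity) hN
    rw [min_eq_right]
    · field_simp
    · rw [div_le_iff₀ hN']
      rw [div_le_iff₀ ht0] at hN
      linarith
  set M := ⌈1 / t⌉₊ with hM
  have hMt : 1 / t ≤ M := Nat.le_ceil _
  have hM1 : 1 ≤ M := Nat.one_le_iff_ne_zero.2 (by
    intro h
    rw [h] at hMt
    have : 0 < 1 / t := by positivity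
    simp at hMt; linarith)
  have hM2 : (M:ℝ) * t ≤ 2 := by
    have := Nat.ceil_lt_add_one (show 0 ≤ 1 / t by positivity)
    rw [← hM] at this
    have h3 : (M:ℝ) * t ≤ (1 / t + 1) * t := by gcongr
    have h4 : (1 / t + 1) * t = 1 + t := by field_simp
    linarith
  have haM : a M ≤ ∑' N : ℕ, w a N * ((N:ℝ) ^ 2 * min t (1 / N)) := by
    have h := w_hasSum a hdec hconv h0 M hM1
    rw [← h.tsum_eq]
    refine h.summable.tsum_le_tsum (fun N => ?_) s2
    rcases le_total N M with hNM | hNM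
    · rw [Nat.sub_eq_zero_of_le hNM]
      simpa using hs0 N
    · rw [heq N (hMt.trans (by exact_mod_cast hNM))]
      gcongr
      · exact hw N
      · omega
  set g : ℕ → ℝ := fun N => if N < M then w a N * (N:ℝ) ^ (k + 1) * t ^ k else 0 with hg
  have hgs : HasSum g (∑ N ∈ Finset.range M, g N) := hasSum_sum_of_ne_finset_zero (by
    intro N hN
    have : ¬ N < M := by simpa using hN
    simp [hg, this])
  have hgle : ∑ N ∈ Finset.range M, g N ≤ A * 2 ^ k * a M := by
    have e : ∑ N ∈ Finset.range M, g N = (∑ N ∈ Finset.range M, w a N * (N:ℝ) ^ (k + 1)) * t ^ k := by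
      rw [Finset.sum_mul]
      refine Finset.sum_congr rfl fun N hN => ?_
      simp [hg, Finset.mem_range.1 hN]
    rw [e]
    have haM0 := a_nonneg a hdec h0 M hM1
    calc _ ≤ A * (a M * (M:ℝ) ^ k) * t ^ k := by gcongr; exact hlow M hM1
      _ = A * ((M:ℝ) * t) ^ k * a M := by rw [mul_pow]; ring
      _ ≤ _ := by gcongr
  have hpt : ∀ N : ℕ, w a N * (N * (min 2 (N * t)) ^ k) ≤ 2 ^ k * (w a N * ((N:ℝ) ^ 2 * min t (1 / N))) + g N := by
    intro N
    have hwN := hw N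
    by_cases hN : 1 / t ≤ N
    · rw [heq N hN]
      have : 0 ≤ g N := by
        simp only [hg]
        split_ifs
        · positivity
        · exact le_rfl
      have h5 : w a N * (N * (min 2 (N * t)) ^ k) ≤ w a N * (N * 2 ^ k) := by
        gcongr; exact min_le_left _ _
      linarith
    · have hNM : N < M := by
        by_contra! hcon
        exact hN (hMt.trans (by exact_mod_cast hcon))
      have h6 : w a N * (N * (min 2 (N * t)) ^ k) ≤ w a N * (N * (N * t) ^ k) := by
        gcongr; exact min_le_right _ _
      have h7 : g N = w a N * (N * (N * t) ^ k) := by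
        simp only [hg, if_pos hNM]; rw [mul_pow]; ring
      have := hs0 N
      have : 0 ≤ 2 ^ k * (w a N * ((N:ℝ) ^ 2 * min t (1 / N))) := by positivity
      linarith
  calc ∑' N : ℕ, w a N * (N * (min 2 (N * t)) ^ k)
      ≤ ∑' N : ℕ, (2 ^ k * (w a N * ((N:ℝ) ^ 2 * min t (1 / N))) + g N) :=
        s1.tsum_le_tsum hpt ((s2.mul_left _).add hgs.summable)
    _ = 2 ^ k * (∑' N : ℕ, w a N * ((N:ℝ) ^ 2 * min t (1 / N))) + ∑ N ∈ Finset.range M, g N := by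
        rw [(s2.mul_left _).tsum_add hgs.summable, tsum_mul_left, hgs.tsum_eq]
    _ ≤ 2 ^ k * (∑' N : ℕ, w a N * ((N:ℝ) ^ 2 * min t (1 / N))) + A * 2 ^ k * a M := by gcongr
    _ ≤ 2 ^ k * (∑' N : ℕ, w a N * ((N:ℝ) ^ 2 * min t (1 / N))) +
          A * 2 ^ k * ∑' N : ℕ, w a N * ((N:ℝ) ^ 2 * min t (1 / N)) := by gcongr
    _ = _ := by ring

end S19
namespace S19

lemma rep (f : ℝ → ℝ) (hfper : Function.Periodic f (2 * π))
    (hfint : IntegrableOn f (Set.Ioo 0 (2 * π)) volume)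
    (a v : ℕ → ℝ) (hv : ∀ N, 0 ≤ v N) (hvs : Summable (fun N => v N * (N : ℝ)))
    (hsum : ∀ j : ℕ, 1 ≤ j → HasSum (fun N => v N * ((N - j : ℕ) : ℝ)) (a j))
    (hcos : ∀ n : ℕ, 1 ≤ n →
      (∫ x in Set.Ioo 0 (2 * π), f x * Real.cos (n * x)) = π * a n)
    (hsin : ∀ n : ℕ, 1 ≤ n → (∫ x in Set.Ioo 0 (2 * π), f x * Real.sin (n * x)) = 0)
    (hmean : (∫ x in Set.Ioo 0 (2 * π), f x) = 0) :
    ∀ᵐ x ∂(volume : Measure ℝ), HasSum (fun N => v N / 2 * K N x) (f x + (∑' N, v N * (N:ℝ)) / 2) := by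
  set A0 := (∑' N, v N * (N:ℝ)) / 2 with hA0
  set F : ℕ → ℝ → ℝ := fun N x => v N / 2 * K N x with hF
  have hF0 : ∀ N x, 0 ≤ F N x := fun N x => mul_nonneg (by have := hv N; positivity) (K_nonneg N x)
  have hFc : ∀ N, Continuous (F N) := fun N => by
    have := K_cont N; simp only [hF]; fun_prop
  have hFint : ∀ N, (∫ x in Set.Ioo 0 (2 * π), F N x) = π * (v N * N) := by
    intro N
    simp only [hF]
    rw [integral_const_mul, int_K]; ring
  set g : ℝ → ℝ := fun x => ∑' N, F N x with hg
  have hlin : (∫⁻ x in Set.Ioo 0 (2 * π), ∑' N, ENNReal.ofReal (F N x)) ≠ ∞ := by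
    rw [lintegral_tsum (fun N => (hFc N).measurable.ennreal_ofReal.aemeasurable)]
    have : ∀ N, (∫⁻ x in Set.Ioo 0 (2 * π), ENNReal.ofReal (F N x)) = ENNReal.ofReal (π * (v N * N)) := by
      intro N
      rw [← ofReal_integral_eq_lintegral_ofReal (contIntR (hFc N)) (ae_of_all _ (hF0 N)), hFint]
    simp_rw [this]
    exact (hvs.mul_left π).tsum_ofReal_ne_top
  have hmeas : Measurable (fun x => ∑' N, ENNReal.ofReal (F N x)) :=
    Measurable.ennreal_tsum fun N => (hFc N).measurable.ennreal_ofReal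
  have hgeq : g = fun x => (∑' N, ENNReal.ofReal (F N x)).toReal := by
    ext x
    rw [ENNReal.tsum_toReal_eq (fun N => ENNReal.ofReal_ne_top)]
    simp only [hg]
    congr 1; ext N
    rw [ENNReal.toReal_ofReal (hF0 N x)]
  have hgint : IntegrableOn g (Set.Ioo 0 (2 * π)) volume := by
    rw [hgeq]
    exact integrable_toReal_of_lintegral_ne_top hmeas.aemeasurable hlin
  have hgsum : ∀ᵐ x ∂(volume.restrict (Set.Ioo (0:ℝ) (2 * π))), HasSum (fun N => F N x) (g x) := by
    filter_upwards [ae_lt_top hmeas hlin] with x hx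
    have := ENNReal.summable_toReal hx.ne
    simp_rw [ENNReal.toReal_ofReal (hF0 _ x)] at this
    exact this.hasSum
  have hφ : ∀ φ : ℝ → ℝ, Continuous φ → (∀ x, |φ x| ≤ 1) →
      HasSum (fun N => ∫ x in Set.Ioo 0 (2 * π), F N x * φ x) (∫ x in Set.Ioo 0 (2 * π), g x * φ x) := by
    intro φ hφ hb
    have h1 : ∀ N, IntegrableOn (fun x => F N x * φ x) (Set.Ioo 0 (2 * π)) volume :=
      fun N => contIntR ((hFc N).mul hφ)
    have := hasSum_integral_of_summable_integral_norm (μ := volume.restrict (Set.Ioo (0:ℝ) (2 * π)))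
      (F := fun N x => F N x * φ x) h1 (by
        refine Summable.of_nonneg_of_le (fun N => integral_nonneg fun x => norm_nonneg _) (fun N => ?_) (hvs.mul_left π)
        rw [← hFint]
        refine integral_mono (h1 N).norm (contIntR (hFc N)) fun x => ?_
        simp only [norm_mul, Real.norm_eq_abs]
        rw [abs_of_nonneg (hF0 N x)]
        exact mul_le_of_le_one_right (hF0 N x) (hb x))
    simp_rw [tsum_mul_right] at this
    exact this
  have hK1 : ∀ x, K 1 x = 1 := by intro x; simp [K, P]
  have hcc : ∀ j : ℕ, (∫ x in Set.Ioo (0:ℝ) (2 * π), Real.cos (j * x)) = 2 * π * (1 - j : ℕ) := by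
    intro j; simpa [hK1] using int_K_cos 1 j
  have hss : ∀ j : ℕ, (∫ x in Set.Ioo (0:ℝ) (2 * π), Real.sin (j * x)) = 0 := by
    intro j; simpa [hK1] using int_K_sin 1 j
  have bdd : ∀ (p φ : ℝ → ℝ), IntegrableOn p (Set.Ioo 0 (2 * π)) volume → Continuous φ → (∀ x, |φ x| ≤ 1) →
      IntegrableOn (fun x => p x * φ x) (Set.Ioo 0 (2 * π)) volume := by
    intro p φ hp hφ hb
    exact Integrable.mul_bdd (c := 1) hp hφ.aestronglyMeasurable (ae_of_all _ hb)
  have split : ∀ φ : ℝ → ℝ, Continuous φ → (∀ x, |φ x| ≤ 1) →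
      (∫ x in Set.Ioo 0 (2 * π), (f x + A0 - g x) * φ x) = (∫ x in Set.Ioo 0 (2 * π), f x * φ x) +
        A0 * (∫ x in Set.Ioo 0 (2 * π), φ x) - ∫ x in Set.Ioo 0 (2 * π), g x * φ x := by
    intro φ hφ hb
    have e : ∀ x, (f x + A0 - g x) * φ x = f x * φ x + A0 * φ x - g x * φ x := by intro x; ring
    simp_rw [e]
    have i1 := bdd f φ hfint hφ hb
    have i2 : IntegrableOn (fun x => A0 * φ x) (Set.Ioo 0 (2 * π)) volume := contIntR (by fun_prop)
    have i3 := bdd g φ hgint hφ hb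
    have i12 : IntegrableOn (fun x => f x * φ x + A0 * φ x) (Set.Ioo 0 (2 * π)) volume := i1.add i2
    rw [integral_sub i12 i3, integral_add i1 i2, integral_const_mul]
  have hu : IntegrableOn (fun x => f x + A0 - g x) (Set.Ioo 0 (2 * π)) volume :=
    (hfint.add (contIntR (continuous_const (y := A0)))).sub hgint
  have key : ∀ᵐ x ∂(volume : Measure ℝ), x ∈ Set.Ioo (0:ℝ) (2 * π) → f x + A0 - g x = 0 := by
    refine uniq _ hu (fun j => ?_) (fun j => ?_)
    · rw [split (fun x => Real.cos (j * x)) (by fun_prop) (fun x => Real.abs_cos_le_one _), hcc]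
      have h1 := hφ (fun x => Real.cos (j * x)) (by fun_prop) (fun x => Real.abs_cos_le_one _)
      have h2 : ∀ N, (∫ x in Set.Ioo 0 (2 * π), F N x * Real.cos (j * x)) = π * (v N * ((N - j : ℕ) : ℝ)) := by
        intro N
        simp only [hF]
        simp_rw [mul_assoc]
        rw [integral_const_mul, int_K_cos]; ring
      simp_rw [h2] at h1
      rcases Nat.eq_zero_or_pos j with rfl | hj
      · simp only [Nat.sub_zero] at h1
        rw [h1.unique (hvs.hasSum.mul_left π)]
        simp only [Nat.cast_zero, zero_mul, Real.cos_zero, mul_one, hmean]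
        rw [hA0]; push_cast; ring
      · rw [h1.unique ((hsum j hj).mul_left π), hcos j hj, Nat.sub_eq_zero_of_le hj]
        simp
    · rw [split (fun x => Real.sin (j * x)) (by fun_prop) (fun x => Real.abs_sin_le_one _), hss]
      have h1 := hφ (fun x => Real.sin (j * x)) (by fun_prop) (fun x => Real.abs_sin_le_one _)
      have h2 : ∀ N, (∫ x in Set.Ioo 0 (2 * π), F N x * Real.sin (j * x)) = 0 := by
        intro N
        simp only [hF]
        simp_rw [mul_assoc]
        rw [integral_const_mul, int_K_sin, mul_zero]
      simp_rw [h2] at h1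
      rw [h1.unique hasSum_zero]
      rcases Nat.eq_zero_or_pos j with rfl | hj
      · simp
      · rw [hsin j hj]; simp
  have key2 : ∀ᵐ x ∂(volume : Measure ℝ), x ∈ Set.Ico (0:ℝ) (2 * π) → HasSum (fun N => F N x) (f x + A0) := by
    have hne : ∀ᵐ x ∂(volume : Measure ℝ), x ≠ 0 := by simp [ae_iff]
    filter_upwards [key, (ae_restrict_iff' measurableSet_Ioo).1 hgsum, hne] with x h1 h2 h3 hx
    have hx' : x ∈ Set.Ioo (0:ℝ) (2 * π) := ⟨lt_of_le_of_ne hx.1 (Ne.symm h3), hx.2⟩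
    have := h2 hx'
    rwa [show g x = f x + A0 by linarith [h1 hx']] at this
  have key3 : ∀ᵐ x ∂(volume : Measure ℝ), ∀ n : ℤ, x - n • (2 * π) ∈ Set.Ico (0:ℝ) (2 * π) →
      HasSum (fun N => F N (x - n • (2 * π))) (f (x - n • (2 * π)) + A0) := by
    rw [ae_all_iff]
    intro n
    exact (measurePreserving_sub_right volume (n • (2 * π))).quasiMeasurePreserving.ae key2
  have hKper : ∀ N, Function.Periodic (K N) (2 * π) := by
    intro N x
    have : P N (fun _ => 1) (x + 2 * π) = P N (fun _ => 1) x := by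
      unfold P
      refine Finset.sum_congr rfl fun j _ => ?_
      congr 1
      rw [Complex.exp_eq_exp_iff_exists_int]
      exact ⟨j, by push_cast; ring⟩
    unfold K; rw [this]
  filter_upwards [key3] with x hx
  obtain ⟨n, hn, -⟩ := existsUnique_sub_zsmul_mem_Ico (show (0:ℝ) < 2 * π by positivity) x 0
  have := hx n (by simpa using hn)
  simp only [hF] at this
  simp_rw [(hKper _).sub_zsmul_eq n] at this
  rwa [hfper.sub_zsmul_eq n] at this

lemma hasSum_iter (F : ℕ → ℝ → ℝ) (f : ℝ → ℝ) (x h : ℝ)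
    (H : ∀ j : ℕ, HasSum (fun N => F N (x + j * h)) (f (x + j * h))) (k : ℕ) :
    ∀ j : ℕ, HasSum (fun N => iterDiffT k h (F N) (x + j * h)) (iterDiffT k h f (x + j * h)) := by
  induction k with
  | zero => exact H
  | succ k ih =>
    intro j
    simp only [iterDiffT, Function.iterate_succ_apply'] at ih ⊢
    simp only [diffOpT]
    have h1 := ih (j + 1)
    have e : x + ((j + 1 : ℕ) : ℝ) * h = x + j * h + h := by push_cast; ring
    rw [e] at h1
    exact h1.sub (ih j)

lemma iter_const (f : ℝ → ℝ) (A0 h : ℝ) (k : ℕ) (hk : 0 < k) :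
    iterDiffT k h (fun x => f x + A0) = iterDiffT k h f := by
  obtain ⟨q, rfl⟩ : ∃ q, k = q + 1 := ⟨k - 1, by omega⟩
  unfold iterDiffT
  rw [Function.iterate_succ_apply, Function.iterate_succ_apply]
  congr 1
  ext x; simp [diffOpT]

lemma iter_mul (f : ℝ → ℝ) (c h : ℝ) (k : ℕ) (x : ℝ) :
    iterDiffT k h (fun x => c * f x) x = c * iterDiffT k h f x := by
  induction k generalizing x with
  | zero => rfl
  | succ k ih =>
    simp only [iterDiffT, Function.iterate_succ_apply'] at ih ⊢
    simp only [diffOpT, ih]; ring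

lemma iter_coe (f : ℝ → ℝ) (h : ℝ) (k : ℕ) (x : ℝ) :
    ((iterDiffT k h f x : ℝ) : ℂ) = (fwdDiff h)^[k] (fun x => (f x : ℂ)) x := by
  induction k generalizing x with
  | zero => rfl
  | succ k ih =>
    simp only [iterDiffT, Function.iterate_succ_apply'] at ih ⊢
    simp only [diffOpT, fwdDiff, ← ih, Complex.ofReal_sub]

lemma lint_iter_K (N k : ℕ) (h : ℝ) :
    (∫⁻ x in Set.Ioo (0:ℝ) (2 * π), ENNReal.ofReal |iterDiffT k h (K N) x|) ≤
      ENNReal.ofReal ((2 * min 2 (N * |h|)) ^ k * (2 * π * N)) := by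
  refine le_of_eq_of_le ?_ (lint_diff_G N h k (fun _ => 1) (fun _ => 1) (by simp) (by simp))
  congr 1; ext x
  have e : G N (fun _ => 1) (fun _ => 1) = fun x => (K N x : ℂ) := by
    ext x; rw [K_coe]; rfl
  rw [e, ← iter_coe, ← ofReal_norm, Complex.norm_real, Real.norm_eq_abs]

lemma iter_cont (k : ℕ) (h : ℝ) (g : ℝ → ℝ) (hg : Continuous g) : Continuous (iterDiffT k h g) := by
  induction k with
  | zero => exact hg
  | succ k ih =>
    have e : iterDiffT (k + 1) h g = diffOpT h (iterDiffT k h g) := by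
      simp only [iterDiffT, Function.iterate_succ_apply']
    rw [e]; unfold diffOpT; fun_prop

lemma upper (f : ℝ → ℝ) (v : ℕ → ℝ) (hv : ∀ N, 0 ≤ v N) (A0 : ℝ)
    (H : ∀ᵐ x ∂(volume : Measure ℝ), HasSum (fun N => v N / 2 * K N x) (f x + A0))
    (k : ℕ) (hk : 0 < k) (t : ℝ)
    (hs : Summable (fun N : ℕ => v N * (N * (min 2 (N * t)) ^ k))) :
    modulusL1T k f t ≤ ENNReal.ofReal (2 ^ k * π * ∑' N : ℕ, v N * (N * (min 2 (N * t)) ^ k)) := by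
  unfold modulusL1T
  refine iSup₂_le fun h hh => ?_
  simp only [mem_ofPred_eq] at hh
  have ht : 0 ≤ t := (abs_nonneg h).trans hh
  have H2 : ∀ᵐ x ∂(volume : Measure ℝ), ∀ j : ℕ, HasSum (fun N => v N / 2 * K N (x + j * h)) (f (x + j * h) + A0) := by
    rw [ae_all_iff]
    intro j
    exact (measurePreserving_add_right volume ((j:ℝ) * h)).quasiMeasurePreserving.ae H
  calc (∫⁻ x in Set.Ioo 0 (2 * π), ENNReal.ofReal |iterDiffT k h f x|)
      ≤ ∫⁻ x in Set.Ioo 0 (2 * π), ∑' N, ENNReal.ofReal (v N / 2) * ENNReal.ofReal |iterDiffT k h (K N) x| := by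
        refine lintegral_mono_ae (ae_restrict_of_ae ?_)
        filter_upwards [H2] with x hx
        have h1 := hasSum_iter (fun N x => v N / 2 * K N x) (fun x => f x + A0) x h hx k 0
        simp only [Nat.cast_zero, zero_mul, add_zero, iter_mul] at h1
        rw [iter_const f A0 h k hk] at h1
        rw [← Real.norm_eq_abs, ofReal_norm, ← h1.tsum_eq]
        refine enorm_tsum_le_tsum_enorm.trans (le_of_eq ?_)
        congr 1; ext N
        rw [← ofReal_norm, norm_mul, Real.norm_of_nonneg (by have := hv N; positivity),
          ENNReal.ofReal_mul (by have := hv N; positivity), Real.norm_eq_abs]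
    _ = ∑' N, ENNReal.ofReal (v N / 2) * ∫⁻ x in Set.Ioo 0 (2 * π), ENNReal.ofReal |iterDiffT k h (K N) x| := by
        have hc := fun N => iter_cont k h (K N) (K_cont N)
        rw [lintegral_tsum (fun N => by have := hc N; fun_prop)]
        congr 1; ext N
        rw [lintegral_const_mul' _ _ ENNReal.ofReal_ne_top]
    _ ≤ ∑' N : ℕ, ENNReal.ofReal (2 ^ k * π * (v N * (N * (min 2 (N * t)) ^ k))) := by
        refine ENNReal.tsum_le_tsum fun N => ?_
        have hvN := hv N
        calc _ ≤ ENNReal.ofReal (v N / 2) * ENNReal.ofReal ((2 * min 2 (N * |h|)) ^ k * (2 * π * N)) := by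
              gcongr; exact lint_iter_K N k h
          _ = ENNReal.ofReal (v N / 2 * ((2 * min 2 (N * |h|)) ^ k * (2 * π * N))) := by
              rw [← ENNReal.ofReal_mul (by positivity)]
          _ ≤ ENNReal.ofReal (v N / 2 * ((2 * min 2 (N * t)) ^ k * (2 * π * N))) := by
              apply ENNReal.ofReal_le_ofReal
              gcongr
          _ = _ := by
              congr 1; rw [mul_pow]; ring
    _ = _ := by
        rw [← tsum_mul_left, ENNReal.ofReal_tsum_of_nonneg (fun N => by have := hv N; positivity) (hs.mul_left _)]

lemma lower (f : ℝ → ℝ) (hfm : Measurable f) (v : ℕ → ℝ) (hv : ∀ N, 0 ≤ v N) (A0 : ℝ)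
    (H : ∀ᵐ x ∂(volume : Measure ℝ), HasSum (fun N => v N / 2 * K N x) (f x + A0)) (t : ℝ) (ht : 0 < t)
    (hs : Summable (fun N : ℕ => v N * ((N:ℝ) ^ 2 * min t (1 / N)))) :
    ENNReal.ofReal (1 / 8 * ∑' N : ℕ, v N * ((N:ℝ) ^ 2 * min t (1 / N))) ≤
      (∫⁻ x in Set.Ioo (0:ℝ) t, ENNReal.ofReal |f x|) + ENNReal.ofReal (A0 * t) := by
  have hnn : ∀ N : ℕ, 0 ≤ 1 / 8 * (v N * ((N:ℝ) ^ 2 * min t (1 / N))) := by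
    intro N
    have := hv N
    have : (0:ℝ) ≤ 1 / N := by positivity
    positivity
  calc ENNReal.ofReal (1 / 8 * ∑' N : ℕ, v N * ((N:ℝ) ^ 2 * min t (1 / N)))
      = ∑' N : ℕ, ENNReal.ofReal (1 / 8 * (v N * ((N:ℝ) ^ 2 * min t (1 / N)))) := by
        rw [← tsum_mul_left, ENNReal.ofReal_tsum_of_nonneg hnn (hs.mul_left _)]
    _ ≤ ∑' N : ℕ, ENNReal.ofReal (v N / 2) * ∫⁻ x in Set.Ioo (0:ℝ) t, ENNReal.ofReal (K N x) := by
        refine ENNReal.tsum_le_tsum fun N => ?_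
        rcases Nat.eq_zero_or_pos N with rfl | hN
        · simp
        have hvN := hv N
        calc _ = ENNReal.ofReal (v N / 2) * ENNReal.ofReal ((N:ℝ) ^ 2 / 4 * min t (1 / N)) := by
              rw [← ENNReal.ofReal_mul (by positivity)]
              congr 1; ring
          _ ≤ _ := by gcongr; exact lint_K_lower N hN t
    _ = ∫⁻ x in Set.Ioo (0:ℝ) t, ∑' N : ℕ, ENNReal.ofReal (v N / 2) * ENNReal.ofReal (K N x) := by
        have hc := K_cont
        rw [lintegral_tsum (fun N => by have := hc N; fun_prop)]
        congr 1; ext N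
        rw [lintegral_const_mul' _ _ ENNReal.ofReal_ne_top]
    _ ≤ ∫⁻ x in Set.Ioo (0:ℝ) t, (ENNReal.ofReal |f x| + ENNReal.ofReal A0) := by
        refine lintegral_mono_ae (ae_restrict_of_ae ?_)
        filter_upwards [H] with x hx
        have e : ∀ N, ENNReal.ofReal (v N / 2) * ENNReal.ofReal (K N x) = ENNReal.ofReal (v N / 2 * K N x) := by
          intro N
          rw [ENNReal.ofReal_mul (by have := hv N; positivity)]
        simp_rw [e]
        rw [← ENNReal.ofReal_tsum_of_nonneg (fun N => mul_nonneg (by have := hv N; positivity) (K_nonneg N x)) hx.summable,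
          hx.tsum_eq]
        refine ENNReal.ofReal_add_le.trans ?_
        gcongr
        exact le_abs_self _
    _ = _ := by
        rw [lintegral_add_left (by fun_prop), setLIntegral_const, Real.volume_Ioo, sub_zero,
          ENNReal.ofReal_mul' ht.le]

end S19

/-- Sharpness of `t f^{**}(t) ≲ ω_1(f,t)_1`: for cosine series with decreasing
convex coefficients satisfying `a_n n^{k-ε} ≲ a_m m^{k-ε}` for `n ≤ m`, one has
`ω_k(f,t)_1 ≲ t f^{**}(t)` (Proposition 4.9). -/
theorem statement19 (k : ℕ) (hk0 : 0 < k)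
    (f : ℝ → ℝ) (hfm : Measurable f) (hfper : Function.Periodic f (2 * π))
    (hfint : IntegrableOn f (Set.Ioo 0 (2 * π)) volume)
    (a : ℕ → ℝ)
    (hdec : ∀ n : ℕ, 1 ≤ n → a (n + 1) ≤ a n)
    (hconv : ∀ n : ℕ, 1 ≤ n → 0 ≤ a n - 2 * a (n + 1) + a (n + 2))
    (hgrowth : ∃ ε C : ℝ, 0 < ε ∧ 0 < C ∧ ∀ n m : ℕ, 1 ≤ n → n ≤ m →
      a n * (n : ℝ) ^ ((k : ℝ) - ε) ≤ C * (a m * (m : ℝ) ^ ((k : ℝ) - ε)))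
    (hcos : ∀ n : ℕ, 1 ≤ n →
      (∫ x in Set.Ioo 0 (2 * π), f x * Real.cos (n * x)) = π * a n)
    (hsin : ∀ n : ℕ, 1 ≤ n → (∫ x in Set.Ioo 0 (2 * π), f x * Real.sin (n * x)) = 0)
    (hmean : (∫ x in Set.Ioo 0 (2 * π), f x) = 0) :
    ∃ C' : ℝ, 0 < C' ∧ ∀ t ∈ Set.Ioo (0 : ℝ) 1,
      modulusL1T k f t ≤
        ENNReal.ofReal C' * (ENNReal.ofReal t * rearrStar torusMeasure f t) := by
  have h0 : Tendsto a atTop (nhds 0) := by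
    have h := (S19.riemLeb f hfint).const_mul (1 / π)
    rw [mul_zero] at h
    refine h.congr' ?_
    filter_upwards [eventually_ge_atTop 1] with n hn
    rw [hcos n hn]
    field_simp
  have hv := S19.w_nonneg a hconv
  have hvs := S19.w_summable a hdec hconv h0
  set A0 := (∑' N, S19.w a N * (N:ℝ)) / 2 with hA0
  have H := S19.rep f hfper hfint a (S19.w a) hv hvs (S19.w_hasSum a hdec hconv h0) hcos hsin hmean
  rw [← hA0] at H
  obtain ⟨A, hA, hnum⟩ := S19.numeric k hk0 a hdec hconv h0 hgrowth
  have hD : ∃ D : ℝ, 0 ≤ D ∧ ∀ t ∈ Set.Ioo (0:ℝ) 1, ENNReal.ofReal (A0 * t) ≤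
      ENNReal.ofReal D * ∫⁻ s in Set.Ioo (0:ℝ) t, rearrR torusMeasure f s := by
    have hA00 : 0 ≤ A0 := by
      rw [hA0]
      have : 0 ≤ ∑' N, S19.w a N * (N:ℝ) := tsum_nonneg fun N => mul_nonneg (hv N) (Nat.cast_nonneg _)
      positivity
    by_cases hf : f =ᵐ[torusMeasure] 0
    · have ha : ∀ n, 1 ≤ n → a n = 0 := by
        intro n hn
        have h1 := hcos n hn
        have h2 : (∫ x in Set.Ioo 0 (2 * π), f x * Real.cos (n * x)) = 0 := by
          refine integral_eq_zero_of_ae ?_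
          have hf' : f =ᵐ[volume.restrict (Set.Ioo 0 (2 * π))] 0 := hf
          filter_upwards [hf'] with x hx
          simp [hx]
        rw [h2] at h1
        rcases mul_eq_zero.1 h1.symm with h | h
        · exact absurd h Real.pi_ne_zero
        · exact h
      have hw : ∀ N, S19.w a N = 0 := by
        intro N
        unfold S19.w
        split_ifs with h
        · rw [ha (N - 1) (by omega), ha N (by omega), ha (N + 1) (by omega)]; ring
        · rfl
      have : A0 = 0 := by rw [hA0]; simp [hw]
      refine ⟨0, le_rfl, fun t _ => ?_⟩
      rw [this]; simp
    · obtain ⟨c, hc, hct⟩ := S19.rearr_lower f hf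
      refine ⟨A0 / c, by positivity, fun t ht => ?_⟩
      calc ENNReal.ofReal (A0 * t) = ENNReal.ofReal (A0 / c) * ENNReal.ofReal (c * t) := by
            rw [← ENNReal.ofReal_mul (by positivity)]
            congr 1; field_simp
        _ ≤ _ := by gcongr; exact hct t ht
  obtain ⟨D, hD0, hD⟩ := hD
  refine ⟨2 ^ k * π * A * 8 * (1 + D), by positivity, fun t ht => ?_⟩
  obtain ⟨s1, s2, hle⟩ := hnum t ht
  have ht' : ENNReal.ofReal t ≠ 0 := by simpa using ht.1
  have hR : ENNReal.ofReal t * rearrStar torusMeasure f t = ∫⁻ s in Set.Ioo (0:ℝ) t, rearrR torusMeasure f s := by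
    unfold rearrStar
    rw [← mul_assoc, ENNReal.mul_inv_cancel ht' ENNReal.ofReal_ne_top, one_mul]
  rw [hR]
  set R := ∫⁻ s in Set.Ioo (0:ℝ) t, rearrR torusMeasure f s with hRdef
  calc modulusL1T k f t ≤ ENNReal.ofReal (2 ^ k * π * ∑' N : ℕ, S19.w a N * (N * (min 2 (N * t)) ^ k)) :=
        S19.upper f _ hv A0 H k hk0 t s1
    _ ≤ ENNReal.ofReal (2 ^ k * π * (A * ∑' N : ℕ, S19.w a N * ((N:ℝ) ^ 2 * min t (1 / N)))) := by
        apply ENNReal.ofReal_le_ofReal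
        gcongr
    _ = ENNReal.ofReal (2 ^ k * π * A * 8) *
          ENNReal.ofReal (1 / 8 * ∑' N : ℕ, S19.w a N * ((N:ℝ) ^ 2 * min t (1 / N))) := by
        rw [← ENNReal.ofReal_mul (by positivity)]
        congr 1; ring
    _ ≤ ENNReal.ofReal (2 ^ k * π * A * 8) * (R + ENNReal.ofReal D * R) := by
        gcongr
        refine (S19.lower f hfm _ hv A0 H t ht.1 s2).trans ?_
        gcongr
        · exact S19.int_le_rearr f hfm hfint t ht.1 ht.2
        · exact hD t ht
    _ = _ := by
        rw [ENNReal.ofReal_mul (p := 2 ^ k * π * A * 8) (by positivity), ENNReal.ofReal_add zero_le_one hD0,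
          ENNReal.ofReal_one]
        ring

end
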